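/- arXiv:1407.3988 — 2 statements merged into one kernel-verified Lean document; each statement's English description precedes it below -/
import Mathlib

section
/- Let A, B, C be the 7×7 zero-one matrices A = [[1,1,1,0,0,0,0],[0,1,0,1,0,0,0],[0,0,1,0,0,1,0],[0,0,0,1,0,0,1],[1,1,1,0,1,0,0],[1,1,1,0,0,1,0],[0,0,0,1,1,0,1]], B = [[1,1,0,0,0,0,0],[0,1,1,0,1,0,0],[0,0,1,0,0,1,1],[0,0,0,1,0,1,1],[1,1,0,0,1,0,0],[0,0,0,0,1,1,0],[0,0,0,1,0,0,1]], C = [[1,1,0,0,0,0,0],[0,1,0,1,1,1,0],[0,0,1,1,1,1,0],[0,0,0,1,0,0,1],[1,0,0,0,1,0,0],[0,0,1,0,0,1,0],[0,0,0,1,1,1,1]], and let J = [[1,0,0,0,0,0,0],[0,0,0,0,1,0,0],[0,0,0,0,0,1,0],[0,0,0,0,0,0,1],[0,1,0,0,0,0,0],[0,0,1,0,0,0,0],[0,0,0,1,0,0,0]]. Then (A, J), (B, J), and (C, J) are flip pairs, and for every positive integer m: p_{2m-1,0}(σ_A, φ_{J,A}) = p_{2m-1,0}(σ_B, φ_{J,B})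 = p_{2m-1,0}(σ_C, φ_{J,C}), p_{2m,0}(σ_A, φ_{J,A}) = p_{2m,0}(σ_B, φ_{J,B}) = p_{2m,0}(σ_C, φ_{J,C}), and p_{2m,1}(σ_A, φ_{J,A}) = p_{2m,1}(σ_B, φ_{J,B}) = p_{2m,1}(σ_C, φ_{J,C}); consequently the Lind zeta functions of the three shift-flip systems coincide. -/
open Matrix

/-- A zero-one integer matrix. -/
def IsZeroOne {α β : Type*} (M : Matrix α β ℤ) : Prop := ∀ a b, M a b = 0 ∨ M a b = 1

/-- A flip pair: a pair `(A, J)` of zero-one square matrices with `AJ = JAᵀ` and `J² = I`. -/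
def IsFlipPair {α : Type*} [Fintype α] [DecidableEq α] (A J : Matrix α α ℤ) : Prop :=
  IsZeroOne A ∧ IsZeroOne J ∧ A * J = J * Aᵀ ∧ J * J = 1

/-- The topological Markov chain `X_A` determined by `A`, as a subtype of `ℤ → α`
(which carries the product topology when `α` is a topological space). -/
abbrev SFT {α : Type*} (A : Matrix α α ℤ) :=
  {x : ℤ → α // ∀ i : ℤ, A (x i) (x (i + 1)) = 1}

/-- The shift map `σ_A` on `X_A`, as a bijection: `σ_A(x)_i = x_{i+1}`. -/
def shiftEquiv {α : Type*} (A : Matrix α α ℤ) : Equiv.Perm (SFT A) where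
  toFun x := ⟨fun i => x.1 (i + 1), fun i => x.2 (i + 1)⟩
  invFun x := ⟨fun i => x.1 (i - 1), fun i => by
    have h := x.2 (i - 1); rwa [show i - 1 + 1 = i + 1 - 1 by ring] at h⟩
  left_inv x := Subtype.ext (funext fun i => by
    show x.1 (i - 1 + 1) = x.1 i
    norm_num)
  right_inv x := Subtype.ext (funext fun i => by
    show x.1 (i + 1 - 1) = x.1 i
    norm_num)

/-- `pFix T m = p_m(T)`: the number of points fixed by `T^m`. -/
noncomputable def pFix {X : Type*} (T : Equiv.Perm X) (m : ℕ) : ℕ :=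
  Nat.card {x : X // (T ^ m) x = x}

/-- `pFlip T φ m n = p_{m,n}(T, φ)`: the number of points fixed by both `T^m` and `T^n ∘ φ`. -/
noncomputable def pFlip {X : Type*} (T : Equiv.Perm X) (φ : X → X) (m : ℕ) (n : ℤ) : ℕ :=
  Nat.card {x : X // (T ^ m) x = x ∧ (T ^ n) (φ x) = x}

/-- Paths with `k` edges in the graph of `A` whose end points satisfy `P`. -/
abbrev PathsWith {α : Type*} (A : Matrix α α ℤ) (k : ℕ) (P : α → α → Prop) :=
  {w : Fin (k + 1) → α // (∀ i : Fin k, A (w i.castSucc) (w i.succ) = 1) ∧ P (w 0) (w (Fin.last k))}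

lemma sum_path_eq_sum_pow {α : Type*} [Fintype α] [DecidableEq α] (A : Matrix α α ℤ) (k : ℕ)
    (f : α → α → ℤ) :
    ∑ w : Fin (k + 1) → α, f (w 0) (w (Fin.last k)) * ∏ i : Fin k, A (w i.castSucc) (w i.succ) =
      ∑ a, ∑ b, f a b * (A ^ k) a b := by
  induction k generalizing f with
  | zero =>
    rw [Fintype.sum_equiv (Equiv.funUnique (Fin 1) α) _ (fun a => f a a) (by intro w; simp)]
    simp [Matrix.one_apply]
  | succ k ih =>
    rw [← (Fin.consEquiv (fun _ : Fin (k + 2) => α)).sum_comp, Fintype.sum_prod_type]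
    refine Finset.sum_congr rfl fun a _ => ?_
    have h := ih (fun c b => f a b * A a c)
    simp only [Fin.consEquiv_apply, Fin.prod_univ_succ, Fin.cons_zero, Fin.castSucc_zero,
      Fin.cons_succ, ← Fin.succ_last, ← Fin.succ_castSucc]
    simp only [mul_assoc] at h
    rw [h, Finset.sum_comm]
    simp only [pow_succ', Matrix.mul_apply, Finset.mul_sum]

lemma natCard_pathsWith {α : Type*} [Fintype α] [DecidableEq α] {A : Matrix α α ℤ}
    (hA : IsZeroOne A) (k : ℕ) (P : α → α → Prop) [∀ a b, Decidable (P a b)] :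
    (Nat.card (PathsWith A k P) : ℤ) = ∑ a, ∑ b, (if P a b then 1 else 0) * (A ^ k) a b := by
  classical
  rw [← sum_path_eq_sum_pow A k (fun a b => if P a b then 1 else 0), Nat.card_eq_fintype_card,
    Fintype.card_subtype, Finset.card_filter, Nat.cast_sum]
  refine Finset.sum_congr rfl fun w _ => ?_
  by_cases hp : ∀ i : Fin k, A (w i.castSucc) (w i.succ) = 1
  · simp [hp]
  · have h0 : ∏ i : Fin k, A (w i.castSucc) (w i.succ) = 0 := by
      push Not at hp
      obtain ⟨i, hi⟩ := hp
      exact Finset.prod_eq_zero (Finset.mem_univ i) ((hA _ _).resolve_right hi)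
    simp [hp, h0]

/-- If restriction to `[0, k]` is a bijection from the points satisfying `Q` to the paths with end
points satisfying `P`, then these sets have the same cardinality. -/
lemma natCard_eq_pathsWith {α : Type*} (A : Matrix α α ℤ) (k : ℕ) (P : α → α → Prop)
    (Q : SFT A → Prop) (hP : ∀ x, Q x → P (x.1 0) (x.1 k))
    (hinj : ∀ x x', Q x → Q x' → (∀ j : ℕ, j ≤ k → x.1 j = x'.1 j) → ∀ i, x.1 i = x'.1 i)
    (hsurj : ∀ y : ℕ → α, (∀ j < k, A (y j) (y (j + 1)) = 1) → P (y 0) (y k) →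
      ∃ x, Q x ∧ ∀ j : ℕ, j ≤ k → x.1 j = y j) :
    Nat.card {x : SFT A // Q x} = Nat.card (PathsWith A k P) := by
  refine Nat.card_eq_of_bijective (fun x => ⟨fun i : Fin (k + 1) => x.1.1 ((i : ℕ) : ℤ),
    fun i => by simpa using x.1.2 (i : ℕ), by simpa using hP x.1 x.2⟩) ⟨?_, ?_⟩
  · intro x x' h
    have h' := congrArg Subtype.val h
    refine Subtype.ext (Subtype.ext (funext (hinj _ _ x.2 x'.2 fun j hj => ?_)))
    exact congrFun h' ⟨j, by omega⟩
  · rintro ⟨w, hw, hwP⟩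
    obtain ⟨x, hx, hxy⟩ := hsurj (fun j => w (Fin.ofNat (k + 1) j)) (fun j hj => by
        convert hw ⟨j, hj⟩ using 3 <;> ext <;> simp <;> omega)
      (by convert hwP using 2 <;> (congr 1; try (ext; simp)))
    refine ⟨⟨x, hx⟩, Subtype.ext (funext fun i => ?_)⟩
    exact (hxy i (by omega)).trans (by simp)

lemma shiftEquiv_pow_apply {α : Type*} (A : Matrix α α ℤ) (N : ℕ) (x : SFT A) (i : ℤ) :
    ((shiftEquiv A ^ N) x).1 i = x.1 (i + N) := by
  induction N generalizing i with
  | zero => simp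
  | succ N ih =>
    rw [pow_succ', Equiv.Perm.mul_apply]
    change ((shiftEquiv A ^ N) x).1 (i + 1) = _
    rw [ih, Nat.cast_succ, add_comm (N : ℤ), add_assoc]

lemma shiftEquiv_pow_eq_self_iff {α : Type*} (A : Matrix α α ℤ) (N : ℕ) (x : SFT A) :
    (shiftEquiv A ^ N) x = x ↔ Function.Periodic x.1 (N : ℤ) := by
  rw [Subtype.ext_iff, funext_iff]
  simp only [shiftEquiv_pow_apply, Function.Periodic]

lemma shiftEquiv_zpow_flip_eq_self_iff {α : Type*} {A : Matrix α α ℤ} {τ : α → α}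
    {φ : SFT A → SFT A} (hφ : ∀ x i, (φ x).1 i = τ (x.1 (-i))) (n : ℕ) (x : SFT A) :
    (shiftEquiv A ^ (n : ℤ)) (φ x) = x ↔ ∀ i, τ (x.1 (-(i + n))) = x.1 i := by
  rw [Subtype.ext_iff, funext_iff, zpow_natCast]
  simp only [shiftEquiv_pow_apply, hφ]

lemma Function.Periodic.apply_emod {α : Type*} {x : ℤ → α} {N : ℤ} (hx : Function.Periodic x N)
    (i : ℤ) : x (i % N) = x i := by
  conv_rhs => rw [← Int.emod_add_mul_ediv i N, mul_comm]
  exact (hx.int_mul (i / N) (i % N)).symm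

lemma Int.toNat_emod_add_one {N : ℕ} (hN : 1 ≤ N) (i : ℤ) :
    ((i % N).toNat + 1 < N ∧ ((i + 1) % N).toNat = (i % N).toNat + 1) ∨
      ((i % N).toNat = N - 1 ∧ ((i + 1) % N).toNat = 0) := by
  have h0 := Int.emod_nonneg i (show (N : ℤ) ≠ 0 by omega)
  have h1 := Int.emod_lt_of_pos i (show (0 : ℤ) < N by omega)
  rw [← Int.emod_add_emod i N 1]
  by_cases h : i % N + 1 = N
  · right
    rw [h, Int.emod_self]
    omega
  · left
    rw [Int.emod_eq_of_lt (a := i % N + 1) (by omega) (by omega)]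
    omega

lemma closed_path_extend {α : Type*} (A : Matrix α α ℤ) {N : ℕ} (hN : 1 ≤ N) (z : ℕ → α)
    (hz : ∀ j, j + 1 < N → A (z j) (z (j + 1)) = 1) (hc : A (z (N - 1)) (z 0) = 1) (i : ℤ) :
    A (z (i % N).toNat) (z ((i + 1) % N).toNat) = 1 := by
  rcases Int.toNat_emod_add_one hN i with ⟨h, h'⟩ | ⟨h, h'⟩
  · rw [h']; exact hz _ h
  · rw [h, h']; exact hc

lemma pFix_eq_natCard_pathsWith {α : Type*} (A : Matrix α α ℤ) (k : ℕ) :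
    pFix (shiftEquiv A) (k + 1) = Nat.card (PathsWith A k fun a b => A b a = 1) := by
  refine natCard_eq_pathsWith A k _ _ ?_ ?_ ?_
  · intro x hx
    rw [shiftEquiv_pow_eq_self_iff] at hx
    have h := x.2 k
    have h0 := hx 0
    push_cast at h0
    rwa [← h0, zero_add]
  · intro x x' hx hx' h i
    rw [shiftEquiv_pow_eq_self_iff] at hx hx'
    rw [← hx.apply_emod, ← hx'.apply_emod]
    have h0 := Int.emod_nonneg i (show ((k + 1 : ℕ) : ℤ) ≠ 0 by omega)
    have h1 := Int.emod_lt_of_pos i (show (0 : ℤ) < (k + 1 : ℕ) by omega)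
    have := h (i % (k + 1 : ℕ)).toNat (by omega)
    rwa [Int.toNat_of_nonneg h0] at this
  · intro y hy hP
    refine ⟨⟨fun i => y (i % (k + 1 : ℕ)).toNat,
      closed_path_extend A (by omega) y (fun j hj => hy j (by omega)) hP⟩, ?_, ?_⟩
    · rw [shiftEquiv_pow_eq_self_iff]
      intro i
      simp
    · intro j hj
      change y _ = y _
      rw [Int.emod_eq_of_lt (by omega) (by omega), Int.toNat_natCast]

/-- The condition on the first symbol of a half period of a point fixed by `σ ^ n ∘ φ`. -/
def FlipStart {α : Type*} (A : Matrix α α ℤ) (τ : α → α) (n : ℕ) (a : α) : Prop :=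
  if n = 0 then τ a = a else A (τ a) a = 1

/-- The condition on the last symbol of a half period, where the reflection is
`i ↦ d - i` for some `d` with the parity of `c`. -/
def FlipEnd {α : Type*} (A : Matrix α α ℤ) (τ : α → α) (c : ℕ) (b : α) : Prop :=
  if c = 0 then τ b = b else A b (τ b) = 1

instance {α : Type*} [DecidableEq α] (A : Matrix α α ℤ) (τ : α → α) (n : ℕ) (a : α) :
    Decidable (FlipStart A τ n a) := by unfold FlipStart; infer_instance

instance {α : Type*} [DecidableEq α] (A : Matrix α α ℤ) (τ : α → α) (c : ℕ) (b : α) :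
    Decidable (FlipEnd A τ c b) := by unfold FlipEnd; infer_instance

lemma neg_add_emod_of_le_one {N n : ℕ} (hN : 1 ≤ N) (hn : n ≤ 1) (i : ℤ) :
    (-(i + n)) % N = if n = 0 ∧ i % N = 0 then 0 else N - n - i % N := by
  have h0 := Int.emod_nonneg i (show (N : ℤ) ≠ 0 by omega)
  have h1 := Int.emod_lt_of_pos i (show (0 : ℤ) < N by omega)
  have h2 := Int.emod_add_mul_ediv i N
  split_ifs with h
  · obtain ⟨rfl, h⟩ := h
    simpa using Int.dvd_of_emod_eq_zero h
  · rw [show -(i + n) = (N - n - i % N) + N * (-(i / N) - 1) by linear_combination h2,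
      Int.add_mul_emod_self_left, Int.emod_eq_of_lt] <;> omega

lemma pFlip_eq_natCard_pathsWith {α : Type*} {A : Matrix α α ℤ} {τ : α → α}
    (hinv : ∀ a, τ (τ a) = a) (hsym : ∀ a b, A a b = 1 → A (τ b) (τ a) = 1)
    {φ : SFT A → SFT A} (hφ : ∀ x i, (φ x).1 i = τ (x.1 (-i)))
    {N n k : ℕ} (hN : 1 ≤ N) (hn : n ≤ 1) (hk : k = (N - n) / 2) :
    pFlip (shiftEquiv A) φ N n =
      Nat.card (PathsWith A k fun a b => FlipStart A τ n a ∧ FlipEnd A τ ((N - n) % 2) b) := by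
  have hrefl : ∀ x : SFT A, ((shiftEquiv A ^ N) x = x ∧ (shiftEquiv A ^ (n : ℤ)) (φ x) = x) →
      Function.Periodic x.1 (N : ℤ) ∧ ∀ i j : ℤ, i + j = N - n → τ (x.1 j) = x.1 i := by
    rintro x ⟨hx, hx'⟩
    rw [shiftEquiv_pow_eq_self_iff] at hx
    rw [shiftEquiv_zpow_flip_eq_self_iff hφ] at hx'
    refine ⟨hx, fun i j hij => ?_⟩
    rw [← hx' i, ← hx (-(i + n)), show j = -(i + n) + N by linarith]
  refine natCard_eq_pathsWith A k _ _ ?_ ?_ ?_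
  · intro x hx
    obtain ⟨hp, hr⟩ := hrefl x hx
    constructor
    · unfold FlipStart
      split_ifs with h
      · subst h
        have := hr 0 N (by omega)
        have h0 := hp 0
        rw [zero_add] at h0
        rwa [h0] at this
      · have h1 := x.2 (-1)
        have h2 := hr (N - 1) 0 (by omega)
        have h3 := hp (-1)
        rw [show (-1 : ℤ) + N = N - 1 by ring] at h3
        rwa [h2, h3]
    · unfold FlipEnd
      split_ifs with h
      · exact hr k k (by omega)
      · have h1 := x.2 k
        rwa [hr (k + 1) k (by omega)]
  · intro x x' hx hx' h i
    obtain ⟨hp, hr⟩ := hrefl x hx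
    obtain ⟨hp', hr'⟩ := hrefl x' hx'
    rw [← hp.apply_emod, ← hp'.apply_emod]
    have h0 := Int.emod_nonneg i (show (N : ℤ) ≠ 0 by omega)
    have h1 := Int.emod_lt_of_pos i (show (0 : ℤ) < N by omega)
    obtain ⟨r, hr0⟩ := Int.eq_ofNat_of_zero_le h0
    rw [hr0] at h1 ⊢
    by_cases hrk : r ≤ k
    · exact h r hrk
    · rw [← hr r (N - n - r : ℕ) (by omega), ← hr' r (N - n - r : ℕ) (by omega),
        h _ (by omega)]
  · rintro y hy ⟨hs, he⟩
    have hy' : ∀ i j, j < k → i = j + 1 → A (τ (y i)) (τ (y j)) = 1 := by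
      rintro i j hj rfl
      exact hsym _ _ (hy j hj)
    have he0 : (N - n) % 2 = 0 → τ (y k) = y k := fun h => by simpa [FlipEnd, h] using he
    have he1 : (N - n) % 2 = 1 → A (y k) (τ (y k)) = 1 := fun h => by simpa [FlipEnd, h] using he
    have hs0 : n = 0 → τ (y 0) = y 0 := fun h => by simpa [FlipStart, h] using hs
    have hs1 : n = 1 → A (τ (y 0)) (y 0) = 1 := fun h => by simpa [FlipStart, h] using hs
    set z : ℕ → α := fun j => if j ≤ k then y j else τ (y (N - n - j)) with hz
    have hz1 : ∀ j, j ≤ k → z j = y j := fun j hj => if_pos hj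
    have hz2 : ∀ j, k < j → z j = τ (y (N - n - j)) := fun j hj => if_neg (by omega)
    clear_value z
    have hpath : ∀ j, j + 1 < N → A (z j) (z (j + 1)) = 1 := by
      intro j hj
      rcases lt_trichotomy j k with h | rfl | h
      · rw [hz1 _ h.le, hz1 _ h]
        exact hy j h
      · rw [hz1 _ le_rfl, hz2 _ (by omega)]
        rcases Nat.mod_two_eq_zero_or_one (N - n) with hc | hc
        · rw [← he0 hc]
          exact hy' _ _ (by omega) (by omega)
        · rw [show N - n - (j + 1) = j by omega]
          exact he1 hc
      · rw [hz2 _ h, hz2 _ (by omega)]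
        exact hy' _ _ (by omega) (by omega)
    have hclose : A (z (N - 1)) (z 0) = 1 := by
      rw [hz1 0 (by omega)]
      rcases (by omega : n = 0 ∨ n = 1) with h | h
      · rw [← hs0 h]
        by_cases hNk : N - 1 ≤ k
        · rw [hz1 _ hNk]
          rcases (by omega : N = 1 ∨ N = 2) with hN1 | hN1
          · rw [show N - 1 = k by omega]
            simpa only [show k = 0 by omega] using he1 (by omega)
          · rw [show N - 1 = k by omega, ← he0 (by omega)]
            exact hy' _ _ (by omega) (by omega)
        · rw [hz2 _ (by omega)]
          exact hy' _ _ (by omega) (by omega)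
      · by_cases hNk : N - 1 ≤ k
        · rw [hz1 _ hNk, show N - 1 = k by omega, ← he0 (by omega), show k = 0 by omega]
          exact hs1 h
        · rw [hz2 _ (by omega), show N - n - (N - 1) = 0 by omega]
          exact hs1 h
    refine ⟨⟨fun i => z (i % N).toNat, closed_path_extend A hN z hpath hclose⟩, ⟨?_, ?_⟩, ?_⟩
    · rw [shiftEquiv_pow_eq_self_iff]
      intro i
      simp
    · rw [shiftEquiv_zpow_flip_eq_self_iff hφ]
      intro i
      change τ (z _) = z _
      have h0 := Int.emod_nonneg i (show (N : ℤ) ≠ 0 by omega)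
      have h1 := Int.emod_lt_of_pos i (show (0 : ℤ) < N by omega)
      rw [neg_add_emod_of_le_one hN hn]
      obtain ⟨r, hr⟩ := Int.eq_ofNat_of_zero_le h0
      rw [hr] at h1 ⊢
      split_ifs with h
      · rw [h.2]
        simpa [hz1] using hs0 h.1
      · rw [show ((N : ℤ) - n - r).toNat = N - n - r by omega, Int.toNat_natCast]
        by_cases hrk : r ≤ k
        · rw [hz1 r hrk]
          by_cases hrc : N - n - r ≤ k
          · rw [hz1 _ hrc, show N - n - r = k by omega, show r = k by omega]
            exact he0 (by omega)
          · rw [hz2 _ (by omega), hinv]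
            congr 1
            omega
        · rw [hz2 r (by omega), hz1 _ (by omega)]
    · intro j hj
      change z _ = _
      by_cases hjN : j < N
      · rw [Int.emod_eq_of_lt (by omega) (by omega), Int.toNat_natCast, hz1 _ hj]
      · omega

/-- `M` is annihilated by `X (X ^ 6 - 7 X ^ 5 + 19 X ^ 4 - 26 X ^ 3 + 19 X ^ 2 - 7 X + 1)`. -/
def IsRecurrent {α : Type*} [Fintype α] [DecidableEq α] (M : Matrix α α ℤ) : Prop :=
  M ^ 7 + 19 • M ^ 5 + 19 • M ^ 3 + M = 7 • M ^ 6 + 26 • M ^ 4 + 7 • M ^ 2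

lemma IsRecurrent.functional_eq {α : Type*} [Fintype α] [DecidableEq α] {M M' : Matrix α α ℤ}
    (hM : IsRecurrent M) (hM' : IsRecurrent M') (f f' : α → α → ℤ)
    (h : ∀ j < 7, ∑ a, ∑ b, f a b * (M ^ j) a b = ∑ a, ∑ b, f' a b * (M' ^ j) a b) (j : ℕ) :
    ∑ a, ∑ b, f a b * (M ^ j) a b = ∑ a, ∑ b, f' a b * (M' ^ j) a b := by
  have key : ∀ (X : Matrix α α ℤ) (g : α → α → ℤ), IsRecurrent X → ∀ j : ℕ,
      ∑ a, ∑ b, g a b * (X ^ (j + 7)) a b = 7 * ∑ a, ∑ b, g a b * (X ^ (j + 6)) a b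
        - 19 * ∑ a, ∑ b, g a b * (X ^ (j + 5)) a b + 26 * ∑ a, ∑ b, g a b * (X ^ (j + 4)) a b
        - 19 * ∑ a, ∑ b, g a b * (X ^ (j + 3)) a b + 7 * ∑ a, ∑ b, g a b * (X ^ (j + 2)) a b
        - ∑ a, ∑ b, g a b * (X ^ (j + 1)) a b := by
    intro X g hX j
    have hX' := congrArg (X ^ j * ·) hX
    simp only [mul_add, mul_smul_comm, ← pow_add, ← pow_succ] at hX'
    simp only [Finset.mul_sum, ← Finset.sum_add_distrib, ← Finset.sum_sub_distrib]
    refine Finset.sum_congr rfl fun a _ => Finset.sum_congr rfl fun b _ => ?_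
    have hab := congrFun (congrFun hX' a) b
    simp only [Matrix.add_apply, Matrix.smul_apply] at hab
    simp only [nsmul_eq_mul, Nat.cast_ofNat] at hab
    linear_combination g a b * hab
  induction j using Nat.strong_induction_on with
  | _ j ih =>
    by_cases hj : j < 7
    · exact h j hj
    · obtain ⟨i, rfl⟩ := Nat.exists_eq_add_of_le' (not_lt.1 hj)
      rw [key M f hM, key M' f' hM', ih _ (by omega), ih _ (by omega), ih _ (by omega),
        ih _ (by omega), ih _ (by omega), ih _ (by omega)]

lemma pFix_eq_of_isRecurrent {α : Type*} [Fintype α] [DecidableEq α] {A B : Matrix α α ℤ}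
    (hA : IsZeroOne A) (hB : IsZeroOne B) (hA' : IsRecurrent A) (hB' : IsRecurrent B)
    (h : ∀ j < 7, ∑ a, ∑ b, (if A b a = 1 then 1 else 0) * (A ^ j) a b =
      ∑ a, ∑ b, (if B b a = 1 then 1 else 0) * (B ^ j) a b) {m : ℕ} (hm : 1 ≤ m) :
    pFix (shiftEquiv A) m = pFix (shiftEquiv B) m := by
  obtain ⟨k, rfl⟩ := Nat.exists_eq_add_of_le' hm
  rw [pFix_eq_natCard_pathsWith, pFix_eq_natCard_pathsWith]
  zify
  rw [natCard_pathsWith hA, natCard_pathsWith hB]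
  exact hA'.functional_eq hB' _ _ h k

lemma pFlip_eq_of_isRecurrent {α : Type*} [Fintype α] [DecidableEq α] {A B : Matrix α α ℤ}
    {τ : α → α} (hinv : ∀ a, τ (τ a) = a) (hA : IsZeroOne A) (hB : IsZeroOne B)
    (hAs : ∀ a b, A a b = 1 → A (τ b) (τ a) = 1) (hBs : ∀ a b, B a b = 1 → B (τ b) (τ a) = 1)
    (hA' : IsRecurrent A) (hB' : IsRecurrent B)
    (h : ∀ n ≤ 1, ∀ c < 2, ∀ j < 7,
      ∑ a, ∑ b, (if FlipStart A τ n a ∧ FlipEnd A τ c b then 1 else 0) * (A ^ j) a b =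
      ∑ a, ∑ b, (if FlipStart B τ n a ∧ FlipEnd B τ c b then 1 else 0) * (B ^ j) a b)
    {φA : SFT A → SFT A} (hφA : ∀ x i, (φA x).1 i = τ (x.1 (-i)))
    {φB : SFT B → SFT B} (hφB : ∀ x i, (φB x).1 i = τ (x.1 (-i)))
    {N n : ℕ} (hN : 1 ≤ N) (hn : n ≤ 1) :
    pFlip (shiftEquiv A) φA N n = pFlip (shiftEquiv B) φB N n := by
  rw [pFlip_eq_natCard_pathsWith hinv hAs hφA hN hn rfl,
    pFlip_eq_natCard_pathsWith hinv hBs hφB hN hn rfl]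
  zify
  rw [natCard_pathsWith hA, natCard_pathsWith hB]
  exact hA'.functional_eq hB' _ _ (h n hn _ (Nat.mod_lt _ two_pos)) _

namespace FlipExample

/-- The involution of the symbols of the three flip pairs. -/
def τ : Fin 7 → Fin 7 := ![0, 4, 5, 6, 1, 2, 3]

/-- The permutation matrix of `τ`. -/
def J : Matrix (Fin 7) (Fin 7) ℤ :=
  !![1,0,0,0,0,0,0; 0,0,0,0,1,0,0; 0,0,0,0,0,1,0; 0,0,0,0,0,0,1;
     0,1,0,0,0,0,0; 0,0,1,0,0,0,0; 0,0,0,1,0,0,0]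

/-- The transition matrix of the first system. -/
def A : Matrix (Fin 7) (Fin 7) ℤ :=
  !![1,1,1,0,0,0,0; 0,1,0,1,0,0,0; 0,0,1,0,0,1,0; 0,0,0,1,0,0,1;
     1,1,1,0,1,0,0; 1,1,1,0,0,1,0; 0,0,0,1,1,0,1]

/-- The transition matrix of the second system. -/
def B : Matrix (Fin 7) (Fin 7) ℤ :=
  !![1,1,0,0,0,0,0; 0,1,1,0,1,0,0; 0,0,1,0,0,1,1; 0,0,0,1,0,1,1;
     1,1,0,0,1,0,0; 0,0,0,0,1,1,0; 0,0,0,1,0,0,1]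

/-- The transition matrix of the third system. -/
def C : Matrix (Fin 7) (Fin 7) ℤ :=
  !![1,1,0,0,0,0,0; 0,1,0,1,1,1,0; 0,0,1,1,1,1,0; 0,0,0,1,0,0,1;
     1,0,0,0,1,0,0; 0,0,1,0,0,1,0; 0,0,0,1,1,1,1]

lemma isFlipPair_A : IsFlipPair A J := by
  refine ⟨fun a b => ?_, fun a b => ?_, by decide +kernel, by decide +kernel⟩ <;>
    fin_cases a <;> fin_cases b <;> decide +kernel

lemma isFlipPair_B : IsFlipPair B J := by
  refine ⟨fun a b => ?_, fun a b => ?_, by decide +kernel, by decide +kernel⟩ <;>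
    fin_cases a <;> fin_cases b <;> decide +kernel

lemma isFlipPair_C : IsFlipPair C J := by
  refine ⟨fun a b => ?_, fun a b => ?_, by decide +kernel, by decide +kernel⟩ <;>
    fin_cases a <;> fin_cases b <;> decide +kernel

lemma isRecurrent_A : IsRecurrent A := by unfold IsRecurrent; decide +kernel

lemma isRecurrent_B : IsRecurrent B := by unfold IsRecurrent; decide +kernel

lemma isRecurrent_C : IsRecurrent C := by unfold IsRecurrent; decide +kernel

lemma τ_τ : ∀ a, τ (τ a) = a := by decide +kernel

lemma A_τ_τ : ∀ a b, A a b = 1 → A (τ b) (τ a) = 1 := by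
  intro a b
  fin_cases a <;> fin_cases b <;> decide +kernel

lemma B_τ_τ : ∀ a b, B a b = 1 → B (τ b) (τ a) = 1 := by
  intro a b
  fin_cases a <;> fin_cases b <;> decide +kernel

lemma C_τ_τ : ∀ a b, C a b = 1 → C (τ b) (τ a) = 1 := by
  intro a b
  fin_cases a <;> fin_cases b <;> decide +kernel

lemma pFix_A_eq_B {m : ℕ} (hm : 1 ≤ m) : pFix (shiftEquiv A) m = pFix (shiftEquiv B) m :=
  pFix_eq_of_isRecurrent isFlipPair_A.1 isFlipPair_B.1 isRecurrent_A isRecurrent_B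
    (by decide +kernel) hm

lemma pFix_B_eq_C {m : ℕ} (hm : 1 ≤ m) : pFix (shiftEquiv B) m = pFix (shiftEquiv C) m :=
  pFix_eq_of_isRecurrent isFlipPair_B.1 isFlipPair_C.1 isRecurrent_B isRecurrent_C
    (by decide +kernel) hm

lemma pFlip_A_eq_B {φA : SFT A → SFT A} (hφA : ∀ x i, (φA x).1 i = τ (x.1 (-i)))
    {φB : SFT B → SFT B} (hφB : ∀ x i, (φB x).1 i = τ (x.1 (-i)))
    {N n : ℕ} (hN : 1 ≤ N) (hn : n ≤ 1) :
    pFlip (shiftEquiv A) φA N n = pFlip (shiftEquiv B) φB N n :=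
  pFlip_eq_of_isRecurrent τ_τ isFlipPair_A.1 isFlipPair_B.1 A_τ_τ B_τ_τ
    isRecurrent_A isRecurrent_B (by decide +kernel) hφA hφB hN hn

lemma pFlip_B_eq_C {φB : SFT B → SFT B} (hφB : ∀ x i, (φB x).1 i = τ (x.1 (-i)))
    {φC : SFT C → SFT C} (hφC : ∀ x i, (φC x).1 i = τ (x.1 (-i)))
    {N n : ℕ} (hN : 1 ≤ N) (hn : n ≤ 1) :
    pFlip (shiftEquiv B) φB N n = pFlip (shiftEquiv C) φC N n :=
  pFlip_eq_of_isRecurrent τ_τ isFlipPair_B.1 isFlipPair_C.1 B_τ_τ C_τ_τ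
    isRecurrent_B isRecurrent_C (by decide +kernel) hφB hφC hN hn

end FlipExample

/-- For the given `7×7` flip pairs `(A, J)`, `(B, J)`, `(C, J)` and every
positive integer `m`, the counts `p_{2m-1,0}`, `p_{2m,0}`, `p_{2m,1}` agree for the three
shift-flip systems (and `p_m(σ)` agree as well), so their Lind zeta functions coincide. -/
theorem stmt18 (A B C J : Matrix (Fin 7) (Fin 7) ℤ)
    (hA : A = !![1,1,1,0,0,0,0; 0,1,0,1,0,0,0; 0,0,1,0,0,1,0; 0,0,0,1,0,0,1;
                 1,1,1,0,1,0,0; 1,1,1,0,0,1,0; 0,0,0,1,1,0,1])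
    (hB : B = !![1,1,0,0,0,0,0; 0,1,1,0,1,0,0; 0,0,1,0,0,1,1; 0,0,0,1,0,1,1;
                 1,1,0,0,1,0,0; 0,0,0,0,1,1,0; 0,0,0,1,0,0,1])
    (hC : C = !![1,1,0,0,0,0,0; 0,1,0,1,1,1,0; 0,0,1,1,1,1,0; 0,0,0,1,0,0,1;
                 1,0,0,0,1,0,0; 0,0,1,0,0,1,0; 0,0,0,1,1,1,1])
    (hJ : J = !![1,0,0,0,0,0,0; 0,0,0,0,1,0,0; 0,0,0,0,0,1,0; 0,0,0,0,0,0,1;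
                 0,1,0,0,0,0,0; 0,0,1,0,0,0,0; 0,0,0,1,0,0,0])
    (τ : Fin 7 → Fin 7) (hτ : ∀ a b, J a b = 1 ↔ τ a = b)
    (φA : SFT A → SFT A) (hφA : ∀ x i, (φA x).1 i = τ (x.1 (-i)))
    (φB : SFT B → SFT B) (hφB : ∀ x i, (φB x).1 i = τ (x.1 (-i)))
    (φC : SFT C → SFT C) (hφC : ∀ x i, (φC x).1 i = τ (x.1 (-i)))
    (m : ℕ) (hm : 1 ≤ m) :
    IsFlipPair A J ∧ IsFlipPair B J ∧ IsFlipPair C J ∧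
    (pFlip (shiftEquiv A) φA (2 * m - 1) 0 = pFlip (shiftEquiv B) φB (2 * m - 1) 0 ∧
      pFlip (shiftEquiv B) φB (2 * m - 1) 0 = pFlip (shiftEquiv C) φC (2 * m - 1) 0) ∧
    (pFlip (shiftEquiv A) φA (2 * m) 0 = pFlip (shiftEquiv B) φB (2 * m) 0 ∧
      pFlip (shiftEquiv B) φB (2 * m) 0 = pFlip (shiftEquiv C) φC (2 * m) 0) ∧
    (pFlip (shiftEquiv A) φA (2 * m) 1 = pFlip (shiftEquiv B) φB (2 * m) 1 ∧
      pFlip (shiftEquiv B) φB (2 * m) 1 = pFlip (shiftEquiv C) φC (2 * m) 1) ∧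
    (pFix (shiftEquiv A) m = pFix (shiftEquiv B) m ∧
      pFix (shiftEquiv B) m = pFix (shiftEquiv C) m) := by
  obtain rfl : A = FlipExample.A := hA
  obtain rfl : B = FlipExample.B := hB
  obtain rfl : C = FlipExample.C := hC
  obtain rfl : J = FlipExample.J := hJ
  obtain rfl : τ = FlipExample.τ := by
    funext a
    refine (hτ a _).1 ?_
    revert a
    decide +kernel
  have h1 : 1 ≤ 2 * m - 1 := by omega
  have h2 : 1 ≤ 2 * m := by omega
  exact ⟨FlipExample.isFlipPair_A, FlipExample.isFlipPair_B, FlipExample.isFlipPair_C,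
    ⟨FlipExample.pFlip_A_eq_B hφA hφB h1 zero_le_one,
      FlipExample.pFlip_B_eq_C hφB hφC h1 zero_le_one⟩,
    ⟨FlipExample.pFlip_A_eq_B hφA hφB h2 zero_le_one,
      FlipExample.pFlip_B_eq_C hφB hφC h2 zero_le_one⟩,
    ⟨FlipExample.pFlip_A_eq_B hφA hφB h2 le_rfl, FlipExample.pFlip_B_eq_C hφB hφC h2 le_rfl⟩,
    FlipExample.pFix_A_eq_B hm, FlipExample.pFix_B_eq_C hm⟩
end

section
/- Let A, B, C be the 7×7 zero-one matrices A = [[1,1,1,0,0,0,0],[0,1,0,1,0,0,0],[0,0,1,0,0,1,0],[0,0,0,1,0,0,1],[1,1,1,0,1,0,0],[1,1,1,0,0,1,0],[0,0,0,1,1,0,1]], B = [[1,1,0,0,0,0,0],[0,1,1,0,1,0,0],[0,0,1,0,0,1,1],[0,0,0,1,0,1,1],[1,1,0,0,1,0,0],[0,0,0,0,1,1,0],[0,0,0,1,0,0,1]], C = [[1,1,0,0,0,0,0],[0,1,0,1,1,1,0],[0,0,1,1,1,1,0],[0,0,0,1,0,0,1],[1,0,0,0,1,0,0],[0,0,1,0,0,1,0],[0,0,0,1,1,1,1]],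 and J = [[1,0,0,0,0,0,0],[0,0,0,0,1,0,0],[0,0,0,0,0,1,0],[0,0,0,0,0,0,1],[0,1,0,0,0,0,0],[0,0,1,0,0,0,0],[0,0,0,1,0,0,0]], so that (A, J), (B, J), (C, J) are flip pairs. Then there is no positive integer k for which there exists a shift-flip equivalence of lag k from (A, J) to (B, J), and likewise no shift-flip equivalence of any lag from (C, J) to (A, J) or from (C, J) to (B, J). In particular, coincidence of the Lind zeta functions of two shift-flip systems of finite type does not imply the existence of a shift-flip equivalence between their flip pairs. -/
open Matrix

/-- A shift-flip equivalence of lag `k` from `(A, J)` to `(B, K)`: a pair `(R, S)` of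
nonnegative integral matrices with `A^k = RS`, `B^k = SR`, `AR = RB`, and `S = KRᵀJ`. -/
def IsShiftFlipEquiv {α β : Type*} [Fintype α] [DecidableEq α] [Fintype β] [DecidableEq β]
    (A J : Matrix α α ℤ) (B K : Matrix β β ℤ) (k : ℕ) : Prop :=
  ∃ (R : Matrix α β ℤ) (S : Matrix β α ℤ),
    (∀ i j, 0 ≤ R i j) ∧ (∀ i j, 0 ≤ S i j) ∧
    A ^ k = R * S ∧ B ^ k = S * R ∧ A * R = R * B ∧ S = K * Rᵀ * J

section Intertwining

variable {α : Type*} [Fintype α] [DecidableEq α] {A B J R : Matrix α α ℤ}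

lemma sub_one_pow_intertwine (h : A * R = R * B) (j : ℕ) :
    (A - 1) ^ j * R = R * (B - 1) ^ j := by
  have h1 : SemiconjBy R (B - 1) (A - 1) := by
    simp only [SemiconjBy, mul_sub, sub_mul, mul_one, one_mul, h]
  exact (h1.pow_right j).symm

/-- A shift-flip equivalence carries the `J`-forms twisted by `B ^ k` to the `J`-forms of `A`. -/
lemma IsShiftFlipEquiv.exists_form_eq {k : ℕ} (h : IsShiftFlipEquiv A J B J k) (hJ : J * J = 1) :
    ∃ R : Matrix α α ℤ, A * R = R * B ∧ ∀ (j : ℕ) (v : α → ℤ),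
      (R *ᵥ v) ⬝ᵥ (J * (A - 1) ^ j) *ᵥ (R *ᵥ v) =
        v ⬝ᵥ (J * (B - 1) ^ j) *ᵥ (B ^ k *ᵥ v) := by
  obtain ⟨R, S, -, -, -, hB, hR, rfl⟩ := h
  refine ⟨R, hR, fun j v => ?_⟩
  have hform : Rᵀ * J * R = J * B ^ k := by
    rw [hB]
    simp only [← mul_assoc, hJ, one_mul]
  have hcomm : Commute (B ^ k) ((B - 1) ^ j) :=
    (((Commute.refl B).sub_right (Commute.one_right B)).pow_pow k j)
  have hmat : Rᵀ * (J * (A - 1) ^ j * R) = J * (B - 1) ^ j * B ^ k := by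
    rw [mul_assoc J, sub_one_pow_intertwine hR, ← mul_assoc, ← mul_assoc, hform, mul_assoc,
      hcomm.eq, mul_assoc]
  rw [mulVec_mulVec, mulVec_mulVec, ← hmat, ← mulVec_mulVec v Rᵀ, dotProduct_mulVec v Rᵀ,
    vecMul_transpose]

/-- If `(C - 1)² (C² - 3C + 1) C` vanishes then so does its counterpart for `A`, after
multiplication by `A ^ k`. -/
lemma IsShiftFlipEquiv.pow_mul_eq_zero {C : Matrix α α ℤ} {k : ℕ}
    (h : IsShiftFlipEquiv C J A J k)
    (hC : (C - 1) ^ 2 * (C ^ 2 - 3 * C + 1) * C = 0) :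
    A ^ k * ((A - 1) ^ 2 * (A ^ 2 - 3 * A + 1) * A) = 0 := by
  obtain ⟨R, S, -, -, -, hA, hR, -⟩ := h
  have h0 : SemiconjBy R A C := hR.symm
  have h1 : SemiconjBy R (A - 1) (C - 1) := by
    simp only [SemiconjBy, mul_sub, sub_mul, mul_one, one_mul, hR]
  have h3 : SemiconjBy R (3 * A) (3 * C) :=
    SemiconjBy.mul_right (show R * 3 = 3 * R from (Nat.cast_ofNat (R := Matrix α α ℤ) (n := 3)) ▸
      (Nat.cast_commute 3 R).eq.symm) h0
  have h2 : SemiconjBy R (A ^ 2 - 3 * A + 1) (C ^ 2 - 3 * C + 1) :=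
    ((h0.pow_right 2).sub_right h3).add_right (SemiconjBy.one_right R)
  have h4 := ((h1.pow_right 2).mul_right h2).mul_right h0
  rw [hA, mul_assoc S, h4.eq, hC, zero_mul, mul_zero]

lemma pow_mulVec_of_fixed {u : α → ℤ} (hu : A *ᵥ u = u) (k : ℕ) : A ^ k *ᵥ u = u := by
  induction k with
  | zero => simp
  | succ k ih => rw [pow_succ, ← mulVec_mulVec, hu, ih]

/-- A matrix with a suitable fixed vector in the image of `(A - 1)² (A² - 3A + 1) A` cannot be
the target of a shift-flip equivalence from a matrix killed by that polynomial. -/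
lemma not_isShiftFlipEquiv_of_fixed {C : Matrix α α ℤ} {w u : α → ℤ}
    (hC : (C - 1) ^ 2 * (C ^ 2 - 3 * C + 1) * C = 0)
    (hw : ((A - 1) ^ 2 * (A ^ 2 - 3 * A + 1) * A) *ᵥ w = u) (hu : A *ᵥ u = u) (hne : u ≠ 0)
    (k : ℕ) : ¬ IsShiftFlipEquiv C J A J k := by
  intro h
  apply hne
  rw [← pow_mulVec_of_fixed hu k, ← hw, mulVec_mulVec, h.pow_mul_eq_zero hC, zero_mulVec]

/-- The action of `B ^ k` on a cyclic vector of a unipotent Jordan block of size four. -/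
lemma exists_pow_mulVec_eq {v n₁ n₂ n₃ : α → ℤ} (h₀ : B *ᵥ v = v + n₁) (h₁ : B *ᵥ n₁ = n₁ + n₂)
    (h₂ : B *ᵥ n₂ = n₂ + n₃) (h₃ : B *ᵥ n₃ = n₃) (k : ℕ) :
    ∃ t s : ℤ, 2 * t = k * (k - 1) ∧ B ^ k *ᵥ v = v + (k : ℤ) • n₁ + t • n₂ + s • n₃ := by
  induction k with
  | zero => exact ⟨0, 0, by simp⟩
  | succ k ih =>
    obtain ⟨t, s, ht, hk⟩ := ih
    refine ⟨t + k, s + t, by push_cast; linarith, ?_⟩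
    rw [pow_succ', ← mulVec_mulVec, hk]
    simp only [mulVec_add, mulVec_smul, h₀, h₁, h₂, h₃]
    push_cast
    module

end Intertwining

/-- The arithmetic obstruction: the Gram data of the Jordan blocks of `A` and `B` at the eigenvalue
`1` cannot be matched over `ℤ`. -/
lemma parity_obstruction {p q b t k : ℤ} (h₃ : (p - q) ^ 2 = 1) (h₂ : 1 + 2 * (p - q) * b = 1 + k)
    (h₁ : -(p ^ 2) + 2 * p * b + q ^ 2 - 2 * q * b + b ^ 2 = k + t) (ht : 2 * t = k * (k - 1)) :
    False := by
  obtain rfl : k = 2 * (p - q) * b := by linarith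
  have hb : Even (b * (b - 1)) := Int.even_mul_pred_self b
  have hb' : Even (b * (b + 1)) := Int.even_mul_succ_self b
  obtain ⟨x, hx⟩ := hb
  obtain ⟨y, hy⟩ := hb'
  rcases (show p - q = 1 ∨ p - q = -1 from by simpa using h₃) with h | h
  · obtain rfl : p = q + 1 := by linarith
    ring_nf at h₁ ht hx
    omega
  · obtain rfl : p = q - 1 := by linarith
    ring_nf at h₁ ht hy
    omega

/-- The matrix `A` of the flip pair `(A, J)`. -/
abbrev matA : Matrix (Fin 7) (Fin 7) ℤ :=
  !![1, 1, 1, 0, 0, 0, 0;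
     0, 1, 0, 1, 0, 0, 0;
     0, 0, 1, 0, 0, 1, 0;
     0, 0, 0, 1, 0, 0, 1;
     1, 1, 1, 0, 1, 0, 0;
     1, 1, 1, 0, 0, 1, 0;
     0, 0, 0, 1, 1, 0, 1]

/-- The matrix `B` of the flip pair `(B, J)`. -/
abbrev matB : Matrix (Fin 7) (Fin 7) ℤ :=
  !![1, 1, 0, 0, 0, 0, 0;
     0, 1, 1, 0, 1, 0, 0;
     0, 0, 1, 0, 0, 1, 1;
     0, 0, 0, 1, 0, 1, 1;
     1, 1, 0, 0, 1, 0, 0;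
     0, 0, 0, 0, 1, 1, 0;
     0, 0, 0, 1, 0, 0, 1]

/-- The common flip matrix. -/
abbrev matJ : Matrix (Fin 7) (Fin 7) ℤ :=
  !![1, 0, 0, 0, 0, 0, 0;
     0, 0, 0, 0, 1, 0, 0;
     0, 0, 0, 0, 0, 1, 0;
     0, 0, 0, 0, 0, 0, 1;
     0, 1, 0, 0, 0, 0, 0;
     0, 0, 1, 0, 0, 0, 0;
     0, 0, 0, 1, 0, 0, 0]

/-- A generator of the generalized eigenspace of `matB` for the eigenvalue `1`. -/
abbrev cyclicVec : Fin 7 → ℤ := ![1, -1, 0, 1, 0, 0, 0]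

lemma matA_form_one : matJ * (matA - 1) ^ 1 =
    !![0, 1, 1, 0, 0, 0, 0;
       1, 1, 1, 0, 0, 0, 0;
       1, 1, 1, 0, 0, 0, 0;
       0, 0, 0, 1, 1, 0, 0;
       0, 0, 0, 1, 0, 0, 0;
       0, 0, 0, 0, 0, 1, 0;
       0, 0, 0, 0, 0, 0, 1] := by
  decide +kernel

lemma matB_form_one : matJ * (matB - 1) ^ 1 =
    !![0, 1, 0, 0, 0, 0, 0;
       1, 1, 0, 0, 0, 0, 0;
       0, 0, 0, 0, 1, 0, 0;
       0, 0, 0, 1, 0, 0, 0;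
       0, 0, 1, 0, 1, 0, 0;
       0, 0, 0, 0, 0, 1, 1;
       0, 0, 0, 0, 0, 1, 1] := by
  decide +kernel

lemma matA_form_two : matJ * (matA - 1) ^ 2 =
    !![0, 0, 0, 1, 0, 1, 0;
       0, 1, 1, 1, 0, 1, 0;
       0, 1, 1, 1, 0, 1, 0;
       1, 1, 1, 0, 0, 0, 1;
       0, 0, 0, 0, 0, 0, 1;
       1, 1, 1, 0, 0, 0, 0;
       0, 0, 0, 1, 1, 0, 0] := by
  decide +kernel

lemma matB_form_two : matJ * (matB - 1) ^ 2 =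
    !![0, 0, 1, 0, 1, 0, 0;
       0, 1, 1, 0, 1, 0, 0;
       1, 1, 0, 0, 0, 0, 0;
       0, 0, 0, 0, 0, 1, 1;
       1, 1, 0, 0, 0, 1, 1;
       0, 0, 0, 1, 1, 0, 0;
       0, 0, 0, 1, 1, 0, 0] := by
  decide +kernel

lemma matA_form_three : matJ * (matA - 1) ^ 3 =
    !![1, 1, 1, 0, 0, 0, 1;
       1, 1, 1, 1, 0, 1, 1;
       1, 1, 1, 1, 0, 1, 1;
       0, 1, 1, 2, 1, 1, 0;
       0, 0, 0, 1, 1, 0, 0;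
       0, 1, 1, 1, 0, 1, 0;
       1, 1, 1, 0, 0, 0, 1] := by
  decide +kernel

lemma matB_form_three : matJ * (matB - 1) ^ 3 =
    !![1, 1, 0, 0, 0, 1, 1;
       1, 1, 1, 0, 1, 1, 1;
       0, 1, 1, 0, 1, 0, 0;
       0, 0, 0, 1, 1, 0, 0;
       0, 1, 1, 1, 2, 0, 0;
       1, 1, 0, 0, 0, 1, 1;
       1, 1, 0, 0, 0, 1, 1] := by
  decide +kernel

lemma matA_sub_one_pow_four : (matA - 1) ^ 4 =
    !![0, 1, 1, 2, 1, 1, 0;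
       1, 1, 1, 0, 0, 0, 1;
       1, 1, 1, 1, 0, 1, 1;
       0, 1, 1, 2, 1, 1, 0;
       1, 2, 2, 2, 1, 1, 1;
       1, 2, 2, 2, 1, 1, 1;
       2, 2, 2, 1, 0, 1, 2] := by
  decide +kernel

lemma not_isShiftFlipEquiv_matA_matB (k : ℕ) : ¬ IsShiftFlipEquiv matA matJ matB matJ k := by
  intro h
  obtain ⟨R, hR, hform⟩ := h.exists_form_eq (by decide +kernel)
  have hker := congrArg (· *ᵥ cyclicVec) (sub_one_pow_intertwine hR 4)
  simp only [← mulVec_mulVec] at hker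
  obtain ⟨t, s, ht, hpow⟩ := exists_pow_mulVec_eq (B := matB) (v := cyclicVec)
    (n₁ := ![-1, 0, 0, 0, 0, 0, 1]) (n₂ := ![0, 0, 1, 1, -1, 0, 0])
    (n₃ := ![0, 0, 0, 0, 0, -1, 1])
    (by decide +kernel) (by decide +kernel) (by decide +kernel) (by decide +kernel) k
  have f₁ := hform 1 cyclicVec
  have f₂ := hform 2 cyclicVec
  have f₃ := hform 3 cyclicVec
  generalize R *ᵥ cyclicVec = w at hker f₁ f₂ f₃
  rw [show (matB - 1) ^ 4 *ᵥ cyclicVec = 0 by decide +kernel, mulVec_zero,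
    matA_sub_one_pow_four] at hker
  rw [hpow, matA_form_one, matB_form_one] at f₁
  rw [hpow, matA_form_two, matB_form_two] at f₂
  rw [hpow, matA_form_three, matB_form_three] at f₃
  simp [funext_iff, Fin.forall_fin_succ, mulVec, dotProduct, Fin.sum_univ_succ] at hker f₁ f₂ f₃
  obtain ⟨e₁, e₂, e₃, -⟩ := hker
  have h3 : w 3 = -w 5 := by linarith
  have h1 : w 1 = -w 2 - w 4 + w 5 := by linarith
  have h0 : w 0 = w 4 - w 5 - w 6 := by linarith
  rw [h3, h1, h0] at f₁ f₂ f₃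
  exact parity_obstruction (p := w 4) (q := w 5) (b := w 6) (by linear_combination f₃)
    (by linear_combination f₂ - f₃) (by linear_combination f₁) ht

/-- For the given `7×7` flip pairs `(A, J)`, `(B, J)`, `(C, J)`: there is
no shift-flip equivalence of any positive lag from `(A, J)` to `(B, J)`, from `(C, J)` to
`(A, J)`, or from `(C, J)` to `(B, J)`. -/
theorem stmt19 (A B C J : Matrix (Fin 7) (Fin 7) ℤ)
    (hA : A = !![1,1,1,0,0,0,0; 0,1,0,1,0,0,0; 0,0,1,0,0,1,0; 0,0,0,1,0,0,1;
                 1,1,1,0,1,0,0; 1,1,1,0,0,1,0; 0,0,0,1,1,0,1])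
    (hB : B = !![1,1,0,0,0,0,0; 0,1,1,0,1,0,0; 0,0,1,0,0,1,1; 0,0,0,1,0,1,1;
                 1,1,0,0,1,0,0; 0,0,0,0,1,1,0; 0,0,0,1,0,0,1])
    (hC : C = !![1,1,0,0,0,0,0; 0,1,0,1,1,1,0; 0,0,1,1,1,1,0; 0,0,0,1,0,0,1;
                 1,0,0,0,1,0,0; 0,0,1,0,0,1,0; 0,0,0,1,1,1,1])
    (hJ : J = !![1,0,0,0,0,0,0; 0,0,0,0,1,0,0; 0,0,0,0,0,1,0; 0,0,0,0,0,0,1;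
                 0,1,0,0,0,0,0; 0,0,1,0,0,0,0; 0,0,0,1,0,0,0]) :
    (¬ ∃ k : ℕ, 0 < k ∧ IsShiftFlipEquiv A J B J k) ∧
    (¬ ∃ k : ℕ, 0 < k ∧ IsShiftFlipEquiv C J A J k) ∧
    (¬ ∃ k : ℕ, 0 < k ∧ IsShiftFlipEquiv C J B J k) := by
  subst hA hB hC hJ
  refine ⟨?_, ?_, ?_⟩
  · rintro ⟨k, -, h⟩
    exact not_isShiftFlipEquiv_matA_matB k h
  · rintro ⟨k, -, h⟩
    refine not_isShiftFlipEquiv_of_fixed (w := ![-1, 0, 0, 0, 0, 0, 1])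
      (u := ![0, -1, 1, 0, 0, 0, 0]) ?_ ?_ ?_ ?_ k h <;> decide +kernel
  · rintro ⟨k, -, h⟩
    refine not_isShiftFlipEquiv_of_fixed (w := ![-1, 0, 0, 0, 0, 1, 0])
      (u := ![0, 0, 0, 0, 0, 1, -1]) ?_ ?_ ?_ ?_ k h <;> decide +kernel
end
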